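/- Let R be a commutative ring, Y a Stone space, f : Y → Σ(R) continuous with respect to the Zariski topology, and let A = {a ∈ LocallyConstant(Y, R) : a(y) ∈ f(y) for all y ∈ Y} be the patch algebra of the patch bundle f. Then for every y ∈ Y, the evaluation map ev_y : A → f(y), a ↦ a(y), is a surjective ring homomorphism whose kernel equals the ideal of A generated by the idempotent elements e of A satisfying e(y) = 0. -/

import Mathlib

/-- The Zariski topology on the set of subrings of a commutative ring `R`,
generated by the sets `{S | r ∈ S}` for `r ∈ R`. -/
instance zariskiTopology (R : Type*) [CommRing R] : TopologicalSpace (Subring R) :=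
  TopologicalSpace.generateFrom {U : Set (Subring R) | ∃ r : R, U = {S : Subring R | r ∈ S}}

/-- The patch algebra of a family `f` of subrings of `R` indexed by a topological
space `Y`: the subring of `LocallyConstant Y R` consisting of the locally constant
functions `a` with `a y ∈ f y` for all `y`. -/
def patchAlgebra (Y : Type*) [TopologicalSpace Y] (R : Type*) [CommRing R]
    (f : Y → Subring R) : Subring (LocallyConstant Y R) where
  carrier := {a : LocallyConstant Y R | ∀ y : Y, a y ∈ f y}
  zero_mem' := fun y => by simpa using zero_mem (f y)
  one_mem' := fun y => by simpa using one_mem (f y)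
  add_mem' := fun {a b} ha hb y => by simpa using add_mem (ha y) (hb y)
  mul_mem' := fun {a b} ha hb y => by simpa using mul_mem (ha y) (hb y)
  neg_mem' := fun {a} ha y => by simpa using neg_mem (ha y)

/-- Evaluation of the patch algebra at a point `y ∈ Y`, as a ring homomorphism into
the subring `f y` of `R`. -/
def evalHom {Y : Type*} [TopologicalSpace Y] {R : Type*} [CommRing R]
    (f : Y → Subring R) (y : Y) : patchAlgebra Y R f →+* f y where
  toFun a := ⟨(a : LocallyConstant Y R) y, a.2 y⟩
  map_one' := rfl
  map_mul' _ _ := rfl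
  map_zero' := rfl
  map_add' _ _ := rfl

/-- Let `R` be a commutative ring, `Y` a Stone space, `f : Y → Σ(R)` continuous for the
Zariski topology, and `A` the patch algebra of the patch bundle `f`.  For every
`y ∈ Y`, evaluation at `y` is a surjective ring homomorphism from `A` onto `f y` whose
kernel is the ideal of `A` generated by the idempotents `e` of `A` with `e y = 0`. -/
theorem evalHom_surjective_and_ker_eq_span_idempotents (R : Type*) [CommRing R]
    (Y : Type*) [TopologicalSpace Y] [CompactSpace Y] [T2Space Y]
    [TotallyDisconnectedSpace Y] (f : Y → Subring R) (hf : Continuous f) (y : Y) :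
    Function.Surjective (evalHom f y) ∧
      RingHom.ker (evalHom f y) =
        Ideal.span {e : patchAlgebra Y R f |
          IsIdempotentElem e ∧ (e : LocallyConstant Y R) y = 0} := by
  classical
  refine ⟨?_, le_antisymm ?_ ?_⟩
  · rintro ⟨r, hr⟩
    have ho : IsOpen {z : Y | r ∈ f z} :=
      (TopologicalSpace.isOpen_generateFrom_of_mem ⟨r, rfl⟩ :
        IsOpen {S : Subring R | r ∈ S}).preimage hf
    obtain ⟨U, hU, hyU, hUs⟩ := compact_exists_isClopen_in_isOpen ho hr
    refine ⟨⟨LocallyConstant.const Y r * LocallyConstant.charFn R hU, fun z => ?_⟩, ?_⟩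
    · by_cases hz : z ∈ U
      · have : r ∈ f z := hUs hz
        simpa [LocallyConstant.coe_charFn, Set.indicator_of_mem hz] using this
      · simp [LocallyConstant.coe_charFn, Set.indicator_of_notMem hz, zero_mem]
    · apply Subtype.ext
      change (LocallyConstant.const Y r * LocallyConstant.charFn R hU) y = r
      simp [LocallyConstant.coe_charFn, Set.indicator_of_mem hyU]
  · intro a ha
    have ha0 : (a : LocallyConstant Y R) y = 0 := congrArg Subtype.val (RingHom.mem_ker.mp ha)
    let g : R → R := fun r => if r = 0 then 0 else 1
    let e : patchAlgebra Y R f := ⟨(a : LocallyConstant Y R).map g, fun z => by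
      change g _ ∈ f z
      dsimp only [g]
      split_ifs
      · exact zero_mem _
      · exact one_mem _⟩
    have hae : a = a * e := by
      apply Subtype.ext
      ext z
      change (a : LocallyConstant Y R) z = (a : LocallyConstant Y R) z * g _
      dsimp only [g]
      split_ifs with h <;> simp [h]
    rw [hae]
    refine Ideal.mul_mem_left _ _ (Ideal.subset_span ⟨?_, ?_⟩)
    · apply Subtype.ext
      ext z
      change g _ * g _ = g _
      dsimp only [g]
      split_ifs <;> simp
    · change g _ = 0
      simp [g, ha0]
  · rw [Ideal.span_le]
    rintro e ⟨-, he⟩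
    exact RingHom.mem_ker.mpr (Subtype.ext he)
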